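/- arXiv:1301.5141 — 4 statements merged into one kernel-verified Lean document; each statement's English description precedes it below -/
import Mathlib

section
/- Let u₀ > 0, C₀ > 0 and let σ: (0, u₀] → (0, ∞) be continuously differentiable with |σ'(u)| ≤ C₀ σ(u)/u for all u ∈ (0, u₀]. Fix c ∈ ℝ and let J = [min(c,0), max(c,0)]. Then for every u with 0 < u ≤ min( u₀/2, 1/(2(|c|+1)) ) one has |σ(u/(1+uc)) − σ(u)| ≤ 2 C₀ u ∫_J σ(u/(1+us)) ds. -/
/-- For σ positive C¹ on `(0,u₀]` with `|σ'(u)| ≤ C₀ σ(u)/u`, and `J = [min(c,0), max(c,0)]`,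
one has `|σ(u/(1+uc)) − σ(u)| ≤ 2 C₀ u ∫_J σ(u/(1+us)) ds` for
`0 < u ≤ min(u₀/2, 1/(2(|c|+1)))`. -/
theorem stmt_5 (u₀ C₀ : ℝ) (hu₀ : 0 < u₀) (hC₀ : 0 < C₀)
    (σ σ' : ℝ → ℝ)
    (hpos : ∀ u ∈ Set.Ioc (0:ℝ) u₀, 0 < σ u)
    (hdiff : ∀ u ∈ Set.Ioc (0:ℝ) u₀, HasDerivWithinAt σ (σ' u) (Set.Ioc 0 u₀) u)
    (hcont : ContinuousOn σ' (Set.Ioc 0 u₀))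
    (hbound : ∀ u ∈ Set.Ioc (0:ℝ) u₀, |σ' u| ≤ C₀ * σ u / u)
    (c : ℝ) :
    ∀ u : ℝ, 0 < u → u ≤ min (u₀ / 2) (1 / (2 * (|c| + 1))) →
      |σ (u / (1 + u * c)) - σ u| ≤
        2 * C₀ * u * ∫ s in Set.uIcc (0:ℝ) c, σ (u / (1 + u * s)) := by
  intro u hu hu'
  obtain ⟨hu1, hu2⟩ := le_min_iff.1 hu'
  have huc : u * |c| < 1 / 2 := by
    rw [le_div_iff₀ (by positivity)] at hu2
    linarith
  have hden : ∀ s ∈ Set.uIcc (0:ℝ) c, 1 / 2 < 1 + u * s := by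
    intro s hs
    have hsc : |s| ≤ |c| := by simpa using Set.abs_sub_left_of_mem_uIcc hs
    have h1 := mul_le_mul_of_nonneg_left ((neg_le_abs s).trans hsc) hu.le
    linarith
  have hv : ∀ s ∈ Set.uIcc (0:ℝ) c, 0 < u / (1 + u * s) ∧ u / (1 + u * s) < 2 * u := by
    intro s hs
    have hd := hden s hs
    have hd0 : 0 < 1 + u * s := by linarith
    refine ⟨by positivity, ?_⟩
    rw [div_lt_iff₀ hd0]
    nlinarith
  have hmaps : Set.MapsTo (fun s ↦ u / (1 + u * s)) (Set.uIcc 0 c) (Set.Ioc 0 u₀) :=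
    fun s hs ↦ ⟨(hv s hs).1, by linarith [(hv s hs).2]⟩
  have hinner : ∀ s ∈ Set.uIcc (0:ℝ) c,
      HasDerivAt (fun s ↦ u / (1 + u * s)) (-(u / (1 + u * s)) ^ 2) s := by
    intro s hs
    have hd0 : 1 + u * s ≠ 0 := by linarith [hden s hs]
    have h := (hasDerivAt_const s u).div (((hasDerivAt_id s).const_mul u).const_add 1) hd0
    refine h.congr_deriv ?_
    simp only [id]
    field_simp
    ring
  have hinner_cont : ContinuousOn (fun s ↦ u / (1 + u * s)) (Set.uIcc 0 c) :=
    fun s hs ↦ (hinner s hs).continuousAt.continuousWithinAt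
  have hderiv : ∀ s ∈ Set.uIcc (0:ℝ) c, HasDerivAt (fun s ↦ σ (u / (1 + u * s)))
      (σ' (u / (1 + u * s)) * -(u / (1 + u * s)) ^ 2) s := by
    intro s hs
    have hσ : HasDerivAt σ (σ' (u / (1 + u * s))) (u / (1 + u * s)) :=
      (hdiff _ (hmaps hs)).hasDerivAt
        (Ioc_mem_nhds (hv s hs).1 (by linarith [(hv s hs).2]))
    exact hσ.comp s (hinner s hs)
  have hg_cont : ContinuousOn (fun s ↦ σ (u / (1 + u * s))) (Set.uIcc 0 c) :=
    fun s hs ↦ (hderiv s hs).continuousAt.continuousWithinAt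
  have hg'_cont : ContinuousOn
      (fun s ↦ σ' (u / (1 + u * s)) * -(u / (1 + u * s)) ^ 2) (Set.uIcc 0 c) :=
    (hcont.comp hinner_cont hmaps).mul (hinner_cont.pow 2).neg
  have hle : ∀ s ∈ Set.uIcc (0:ℝ) c,
      ‖σ' (u / (1 + u * s)) * -(u / (1 + u * s)) ^ 2‖ ≤
        2 * C₀ * u * σ (u / (1 + u * s)) := by
    intro s hs
    obtain ⟨hv0, hv2⟩ := hv s hs
    have hv_mem : u / (1 + u * s) ∈ Set.Ioc 0 u₀ := hmaps hs
    generalize u / (1 + u * s) = v at hv0 hv2 hv_mem ⊢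
    have hb := hbound v hv_mem
    have hp := hpos v hv_mem
    rw [Real.norm_eq_abs, abs_mul, abs_neg, abs_of_pos (pow_pos hv0 2)]
    calc |σ' v| * v ^ 2 ≤ C₀ * σ v / v * v ^ 2 := by gcongr
      _ = C₀ * σ v * v := by field_simp
      _ ≤ C₀ * σ v * (2 * u) := by gcongr
      _ = 2 * C₀ * u * σ v := by ring
  have hint : MeasureTheory.IntegrableOn
      (fun s ↦ 2 * C₀ * u * σ (u / (1 + u * s))) (Set.uIcc 0 c) :=
    (hg_cont.const_mul _).integrableOn_compact isCompact_uIcc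
  have hftc := intervalIntegral.integral_eq_sub_of_hasDerivAt hderiv
    hg'_cont.intervalIntegrable
  simp only [mul_zero, add_zero, div_one] at hftc
  rw [← hftc, ← Real.norm_eq_abs, ← MeasureTheory.integral_const_mul]
  refine intervalIntegral.norm_integral_le_integral_norm_uIoc.trans ?_
  calc ∫ s in Set.uIoc 0 c, ‖σ' (u / (1 + u * s)) * -(u / (1 + u * s)) ^ 2‖
      ≤ ∫ s in Set.uIcc 0 c, ‖σ' (u / (1 + u * s)) * -(u / (1 + u * s)) ^ 2‖ :=
        MeasureTheory.setIntegral_mono_set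
          (hg'_cont.norm.integrableOn_compact isCompact_uIcc)
          (Filter.Eventually.of_forall fun _ ↦ norm_nonneg _)
          Set.uIoc_subset_uIcc.eventuallyLE
    _ ≤ ∫ s in Set.uIcc 0 c, 2 * C₀ * u * σ (u / (1 + u * s)) :=
        MeasureTheory.setIntegral_mono_on
          (hg'_cont.norm.integrableOn_compact isCompact_uIcc) hint measurableSet_uIcc hle
end

section
/- Let u₀ > 0, C₀ > 0 and let σ: (0, u₀] → (0, ∞) be continuously differentiable with |σ'(u)| ≤ C₀ σ(u)/u for all u ∈ (0, u₀]. Fix c ∈ ℝ and define m(u) = (1+uc)^{−2} · σ(u/(1+uc)) / σ(u) for small u > 0. Then there exist δ > 0 and C > 0 such that |log m(u)| ≤ C u for all u ∈ (0, δ]. -/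
/-- If `|σ'(u)| ≤ C₀ σ(u) / u` on `(0, u₀]`, then `log ∘ σ` is Lipschitz on `[r, u₀]` with
constant `C₀ / r`. -/
theorem abs_log_sub_log_le_of_abs_deriv_le {u₀ C₀ : ℝ} (hC₀ : 0 ≤ C₀) {σ σ' : ℝ → ℝ}
    (hpos : ∀ u ∈ Set.Ioc (0:ℝ) u₀, 0 < σ u)
    (hdiff : ∀ u ∈ Set.Ioc (0:ℝ) u₀, HasDerivWithinAt σ (σ' u) (Set.Ioc 0 u₀) u)
    (hbound : ∀ u ∈ Set.Ioc (0:ℝ) u₀, |σ' u| ≤ C₀ * σ u / u)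
    {r x y : ℝ} (hr : 0 < r) (hx : x ∈ Set.Icc r u₀) (hy : y ∈ Set.Icc r u₀) :
    |Real.log (σ y) - Real.log (σ x)| ≤ C₀ / r * |y - x| := by
  have hsub : Set.Icc r u₀ ⊆ Set.Ioc 0 u₀ := fun z hz => ⟨hr.trans_le hz.1, hz.2⟩
  refine (convex_Icc r u₀).norm_image_sub_le_of_norm_hasDerivWithin_le
    (f := fun z => Real.log (σ z)) (f' := fun z => σ' z / σ z)
    (fun z hz => ((hdiff z (hsub hz)).mono hsub).log (hpos z (hsub hz)).ne')
    (fun z hz => ?_) hx hy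
  have hσ := hpos z (hsub hz)
  rw [Real.norm_eq_abs, abs_div, abs_of_pos hσ, div_le_iff₀ hσ]
  calc |σ' z| ≤ C₀ * σ z / z := hbound z (hsub hz)
    _ ≤ C₀ * σ z / r := by
      gcongr
      exact hz.1
    _ = C₀ / r * σ z := by ring

theorem abs_log_one_add_le {x : ℝ} (hx : |x| ≤ 1 / 2) : |Real.log (1 + x)| ≤ 2 * |x| := by
  have h := abs_le.1 hx
  have hpos : 0 < 1 + x := by linarith
  rw [abs_le]
  constructor
  · have hinv : -(2 * |x|) ≤ 1 - (1 + x)⁻¹ := by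
      have heq : 1 - (1 + x)⁻¹ = x / (1 + x) := by field_simp; ring
      rw [heq, le_div_iff₀ hpos]
      nlinarith [neg_abs_le x, abs_nonneg x]
    exact hinv.trans (Real.one_sub_inv_le_log_of_pos hpos)
  · linarith [Real.log_le_sub_one_of_pos hpos, le_abs_self x, abs_nonneg x]


/-- For σ positive C¹ on `(0,u₀]` with `|σ'(u)| ≤ C₀ σ(u)/u` and fixed `c`, the density
`m(u) = (1+uc)^{-2} σ(u/(1+uc))/σ(u)` satisfies `|log m(u)| ≤ C u` for small `u > 0`. -/
theorem stmt_6 (u₀ C₀ : ℝ) (hu₀ : 0 < u₀) (hC₀ : 0 < C₀)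
    (σ σ' : ℝ → ℝ)
    (hpos : ∀ u ∈ Set.Ioc (0:ℝ) u₀, 0 < σ u)
    (hdiff : ∀ u ∈ Set.Ioc (0:ℝ) u₀, HasDerivWithinAt σ (σ' u) (Set.Ioc 0 u₀) u)
    (hcont : ContinuousOn σ' (Set.Ioc 0 u₀))
    (hbound : ∀ u ∈ Set.Ioc (0:ℝ) u₀, |σ' u| ≤ C₀ * σ u / u)
    (c : ℝ) :
    ∃ δ : ℝ, 0 < δ ∧ ∃ C : ℝ, 0 < C ∧ ∀ u : ℝ, 0 < u → u ≤ δ →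
      |Real.log (((1 + u * c) ^ 2)⁻¹ * σ (u / (1 + u * c)) / σ u)| ≤ C * u := by
  have hk : 0 < |c| + 1 := by positivity
  refine ⟨min (u₀ / 2) (1 / (2 * (|c| + 1))), by positivity,
    4 * C₀ * |c| + 4 * |c| + 1, by positivity, fun u hu hδ => ?_⟩
  have hu2 : u ≤ u₀ / 2 := hδ.trans (min_le_left _ _)
  have huc : |u * c| ≤ 1 / 2 := by
    have h := hδ.trans (min_le_right _ _)
    rw [le_div_iff₀ (by positivity)] at h
    rw [abs_mul, abs_of_pos hu]
    nlinarith
  have hab := abs_le.1 huc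
  have hw : 0 < 1 + u * c := by linarith
  set v := u / (1 + u * c) with hv
  have hvl : u / 2 ≤ v := by
    rw [hv, le_div_iff₀ hw]
    nlinarith
  have hvu : v ≤ 2 * u := by
    rw [hv, div_le_iff₀ hw]
    nlinarith
  have hv0 : 0 < v := by positivity
  have hdist : |v - u| ≤ 2 * u * (u * |c|) := by
    have heq : v - u = -(v * (u * c)) := by
      rw [hv]
      field_simp
      ring
    rw [heq, abs_neg, abs_mul, abs_mul, abs_of_pos hv0, abs_of_pos hu]
    gcongr
  have hσ : |Real.log (σ v) - Real.log (σ u)| ≤ 4 * C₀ * |c| * u :=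
    calc |Real.log (σ v) - Real.log (σ u)| ≤ C₀ / (u / 2) * |v - u| :=
          abs_log_sub_log_le_of_abs_deriv_le hC₀.le hpos hdiff hbound (by positivity)
            ⟨by linarith, by linarith⟩ ⟨hvl, by linarith⟩
      _ ≤ C₀ / (u / 2) * (2 * u * (u * |c|)) := by gcongr
      _ = 4 * C₀ * |c| * u := by
        field_simp
        ring
  have hσu := hpos u ⟨hu, by linarith⟩
  have hσv := hpos v ⟨hv0, by linarith⟩
  have hlog : Real.log (((1 + u * c) ^ 2)⁻¹ * σ v / σ u) =
      (Real.log (σ v) - Real.log (σ u)) - 2 * Real.log (1 + u * c) := by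
    rw [Real.log_div (by positivity) hσu.ne', Real.log_mul (by positivity) hσv.ne',
      Real.log_inv, Real.log_pow]
    push_cast
    ring
  have hlog1 := abs_log_one_add_le huc
  rw [abs_mul u c, abs_of_pos hu] at hlog1
  rw [hlog]
  refine (abs_sub _ _).trans ?_
  rw [abs_mul, abs_two]
  linarith
end

section
/- Let ρ: ℝ → ℝ be continuously differentiable with bounded derivative, let Q be the flow of ρ (∂_c Q(c,x) = ρ(Q(c,x)), Q(0,x) = x) and set R(c,x) = exp( ∫₀^c ρ'(Q(s,x)) ds ). Let u ∈ ℝ and let σ be a real-valued function defined on a neighbourhood of u, differentiable at u, with σ(u) > 0. Then the function c ↦ σ(Q(−c,u)) / ( R(c, Q(−c,u)) · σ(u) ) is differentiable at c = 0, and its derivative there equals −( σ'(u) ρ(u) + σ(u) ρ'(u) ) / σ(u). -/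
theorem flow_add_of_lipschitzWith {K : NNReal} {ρ : ℝ → ℝ} (hρ : LipschitzWith K ρ)
    {Q : ℝ → ℝ → ℝ} (hQ : ∀ x c, HasDerivAt (fun c' => Q c' x) (ρ (Q c x)) c)
    (hQ0 : ∀ x, Q 0 x = x) (s t x : ℝ) : Q s (Q t x) = Q (s + t) x := by
  have h := ODE_solution_unique_univ (v := fun _ => ρ) (s := fun _ => Set.univ) (K := K)
    (f := fun r => Q r (Q t x)) (g := fun r => Q (r + t) x) (t₀ := 0)
    (fun _ => hρ.lipschitzOnWith)
    (fun r => ⟨hQ (Q t x) r, Set.mem_univ _⟩)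
    (fun r => ⟨(hQ x (r + t)).comp_add_const r t, Set.mem_univ _⟩)
    (by simp [hQ0])
  exact congrFun h s

/-- With `Q` the flow of a C¹ vector field ρ with bounded derivative and
`R(c,x) = exp(∫₀^c ρ'(Q(s,x)) ds)`, for σ differentiable at `u` with `σ(u) > 0`, the map
`c ↦ σ(Q(-c,u)) / (R(c,Q(-c,u)) σ(u))` is differentiable at `0` with derivative
`−(σ'(u) ρ(u) + σ(u) ρ'(u))/σ(u)`. -/
theorem stmt_9 (ρ : ℝ → ℝ) (hρ : ContDiff ℝ 1 ρ) (M : ℝ)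
    (hM : ∀ x, |deriv ρ x| ≤ M)
    (Q : ℝ → ℝ → ℝ)
    (hQ : ∀ x c, HasDerivAt (fun c' => Q c' x) (ρ (Q c x)) c)
    (hQ0 : ∀ x, Q 0 x = x)
    (u : ℝ) (σ : ℝ → ℝ) (σ'u : ℝ) (hσ : HasDerivAt σ σ'u u) (hσpos : 0 < σ u) :
    HasDerivAt (fun c =>
        σ (Q (-c) u) /
          (Real.exp (∫ s in (0:ℝ)..c, deriv ρ (Q s (Q (-c) u))) * σ u))
      (-(σ'u * ρ u + σ u * deriv ρ u) / σ u) 0 := by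
  have hlip : LipschitzWith M.toNNReal ρ :=
    lipschitzWith_of_nnnorm_deriv_le (hρ.differentiable one_ne_zero) fun x => by
      rw [← NNReal.coe_le_coe, coe_nnnorm, Real.norm_eq_abs]
      exact (hM x).trans (Real.le_coe_toNNReal M)
  have hQu : Continuous fun s => Q s u :=
    continuous_iff_continuousAt.2 fun s => (hQ u s).continuousAt
  have hcont : Continuous fun s => deriv ρ (Q s u) :=
    (hρ.continuous_deriv le_rfl).comp hQu
  have hint (c : ℝ) : ∫ s in (0 : ℝ)..c, deriv ρ (Q s (Q (-c) u)) =
      -∫ s in (0 : ℝ)..(-c), deriv ρ (Q s u) := by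
    simp_rw [flow_add_of_lipschitzWith hlip hQ hQ0]
    rw [intervalIntegral.integral_comp_add_right (fun s => deriv ρ (Q s u)) (-c),
      zero_add, add_neg_cancel, intervalIntegral.integral_symm]
  simp_rw [hint]
  have hneg : HasDerivAt (fun c : ℝ => -c) (-1) 0 := hasDerivAt_neg 0
  have hI : HasDerivAt (fun c : ℝ => -∫ s in (0 : ℝ)..(-c), deriv ρ (Q s u))
      (deriv ρ u) 0 := by
    have h := (HasDerivAt.comp (0 : ℝ)
      (hcont.integral_hasStrictDerivAt 0 (-0)).hasDerivAt hneg).neg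
    exact h.congr_deriv (by simp [hQ0])
  have hq : HasDerivAt (fun c => Q (-c) u) (-ρ u) 0 := by
    have h := HasDerivAt.comp (0 : ℝ) (hQ u (-0)) hneg
    simpa [hQ0, Function.comp_def] using h
  have hσQ : HasDerivAt (fun c => σ (Q (-c) u)) (σ'u * -ρ u) 0 :=
    HasDerivAt.comp (0 : ℝ) (by simpa [hQ0] using hσ) hq
  have hne := hσpos.ne'
  refine (hσQ.div (hI.exp.mul_const (σ u)) (by positivity)).congr_deriv ?_
  simp only [neg_zero, intervalIntegral.integral_same, Real.exp_zero, hQ0]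
  field_simp
  ring
end

section
/- Let (X, 𝒜, λ) be a measure space, let p, g: X → ℝ be measurable with p ≥ 0, let r > 2, and suppose ∫_X |g|^r p dλ ≤ A and ∫_X √p dλ ≤ B for finite constants A, B. Then for every ε > 0, ∫_{{x : p(x) ≤ ε}} g² p dλ ≤ A^{2/r} · ( √ε · B )^{(r−2)/r}. -/
open MeasureTheory

/-- The Hölder factorisation of `g² p`, with weights `2 / r` and `(r - 2) / r`. -/
theorem sq_mul_eq_rpow_mul_rpow {r : ℝ} (hr : 2 < r) (g : ℝ) {p : ℝ} (hp : 0 ≤ p) :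
    g ^ 2 * p = (|g| ^ r * p) ^ (2 / r) * p ^ ((r - 2) / r) := by
  have hr0 : r ≠ 0 := by linarith
  have hsum : 2 / r + (r - 2) / r = 1 := by field_simp; ring
  rw [Real.mul_rpow (by positivity) hp, ← Real.rpow_mul (abs_nonneg g), mul_div_cancel₀ _ hr0,
    Real.rpow_two, sq_abs, mul_assoc, ← Real.rpow_add' hp (by rw [hsum]; exact one_ne_zero), hsum,
    Real.rpow_one]

/-- The mass of `p` on the sublevel set `{p ≤ ε}` is at most `√ε ∫ √p`. -/
theorem setLIntegral_sublevel_le_sqrt_mul {X : Type*} [MeasurableSpace X] (μ : Measure X)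
    {p : X → ℝ} (hp : Measurable p) (hp0 : ∀ x, 0 ≤ p x) (ε : ℝ) :
    ∫⁻ x in {x | p x ≤ ε}, ENNReal.ofReal (p x) ∂μ ≤
      ENNReal.ofReal (√ε) * ∫⁻ x, ENNReal.ofReal (√(p x)) ∂μ := by
  rw [← lintegral_const_mul _ (by fun_prop)]
  refine le_trans (setLIntegral_mono (by fun_prop) fun x hx => ?_) (setLIntegral_le_lintegral _ _)
  rw [← ENNReal.ofReal_mul (Real.sqrt_nonneg _)]
  refine ENNReal.ofReal_le_ofReal ?_
  calc p x = √(p x) * √(p x) := (Real.mul_self_sqrt (hp0 x)).symm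
    _ ≤ √ε * √(p x) := by gcongr; exact hx

/-- Hölder estimate: if `∫ |g|^r p dλ ≤ A` and `∫ √p dλ ≤ B` with `r > 2`, then
`∫_{p ≤ ε} g² p dλ ≤ A^{2/r} (√ε B)^{(r−2)/r}`. -/
theorem stmt_12 {X : Type*} [MeasurableSpace X] (lam : Measure X)
    (p g : X → ℝ) (hp : Measurable p) (hg : Measurable g) (hp0 : ∀ x, 0 ≤ p x)
    (r : ℝ) (hr : 2 < r) (A B : ℝ) (hA : 0 ≤ A) (hB : 0 ≤ B)
    (hgA : ∫⁻ x, ENNReal.ofReal (|g x| ^ r * p x) ∂lam ≤ ENNReal.ofReal A)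
    (hpB : ∫⁻ x, ENNReal.ofReal (Real.sqrt (p x)) ∂lam ≤ ENNReal.ofReal B) :
    ∀ ε : ℝ, 0 < ε →
      ∫⁻ x in {x | p x ≤ ε}, ENNReal.ofReal ((g x) ^ 2 * p x) ∂lam ≤
        ENNReal.ofReal (A ^ (2 / r) * (Real.sqrt ε * B) ^ ((r - 2) / r)) := by
  intro ε _
  have hs : 0 ≤ (r - 2) / r := div_nonneg (by linarith) (by linarith)
  have ht : 0 ≤ 2 / r := div_nonneg (by norm_num) (by linarith)
  have hsum : 2 / r + (r - 2) / r = 1 := by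
    have hr0 : r ≠ 0 := by linarith
    field_simp
    ring
  have hfactor (x : X) : ENNReal.ofReal (g x ^ 2 * p x) =
      ENNReal.ofReal (|g x| ^ r * p x) ^ (2 / r) * ENNReal.ofReal (p x) ^ ((r - 2) / r) := by
    have hgp : 0 ≤ |g x| ^ r * p x := mul_nonneg (by positivity) (hp0 x)
    rw [sq_mul_eq_rpow_mul_rpow hr (g x) (hp0 x), ENNReal.ofReal_mul (Real.rpow_nonneg hgp _),
      ENNReal.ofReal_rpow_of_nonneg hgp ht, ENNReal.ofReal_rpow_of_nonneg (hp0 x) hs]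
  have hmeas : Measurable fun x => |g x| ^ r * p x :=
    ((measurable_norm.comp hg).pow_const r).mul hp
  simp_rw [hfactor]
  calc
    _ ≤ (∫⁻ x in {x | p x ≤ ε}, ENNReal.ofReal (|g x| ^ r * p x) ∂lam) ^ (2 / r) *
        (∫⁻ x in {x | p x ≤ ε}, ENNReal.ofReal (p x) ∂lam) ^ ((r - 2) / r) :=
      ENNReal.lintegral_mul_norm_pow_le hmeas.ennreal_ofReal.aemeasurable
        hp.ennreal_ofReal.aemeasurable ht hs hsum
    _ ≤ ENNReal.ofReal A ^ (2 / r) *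
        (ENNReal.ofReal (√ε) * ENNReal.ofReal B) ^ ((r - 2) / r) := by
      gcongr
      · exact (setLIntegral_le_lintegral _ _).trans hgA
      · exact (setLIntegral_sublevel_le_sqrt_mul lam hp hp0 ε).trans (by gcongr)
    _ = ENNReal.ofReal (A ^ (2 / r) * (√ε * B) ^ ((r - 2) / r)) := by
      rw [← ENNReal.ofReal_mul (Real.sqrt_nonneg _), ENNReal.ofReal_rpow_of_nonneg hA ht,
        ENNReal.ofReal_rpow_of_nonneg (by positivity) hs, ENNReal.ofReal_mul (by positivity)]
end
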